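/- Under the assumptions and parameter conditions of the descent lemma (f differentiable convex with L_f-Lipschitz gradient; f + ‖A·‖₂²/2 strongly convex with parameter δ; h convex; g differentiable concave with L_g-Lipschitz derivative and g' > 0 on the range of h; θ > 0 with ‖Aᵀu‖₂ ≥ θ‖u‖₂ on the column space of A; η = L_f²/θ²; column space of B and c contained in the column space of A; α > max{1, 2η/δ}; ρ > α‖B‖²), if the sequence {(x^k, y^k, p^k)}_{k≥0} generated by ILR-ADMM is bounded, then ‖x^{k+1} − x^k‖₂ + ‖y^{k+1} − y^k‖₂ → 0 and ‖p^{k+1} − p^k‖₂ → 0 as k → ∞. -/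

import Mathlib

open Matrix Filter Topology RealInnerProductSpace

/-- `A` acting on a Euclidean vector. -/
noncomputable def matVec {r n : ℕ} (A : Matrix (Fin r) (Fin n) ℝ)
    (x : EuclideanSpace ℝ (Fin n)) : EuclideanSpace ℝ (Fin r) :=
  Matrix.toEuclideanLin A x

/-- The operator 2-norm of a matrix. -/
noncomputable def opNorm2 {r n : ℕ} (A : Matrix (Fin r) (Fin n) ℝ) : ℝ :=
  ‖LinearMap.toContinuousLinearMap (Matrix.toEuclideanLin A)‖

/-- The augmented Lagrangian `L_α(x,y,p)`. -/
noncomputable def Lag {M N r : ℕ} (f : EuclideanSpace ℝ (Fin M) → ℝ) (g h : ℝ → ℝ)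
    (A : Matrix (Fin r) (Fin M) ℝ) (B : Matrix (Fin r) (Fin N) ℝ)
    (c : EuclideanSpace ℝ (Fin r)) (α : ℝ) (x : EuclideanSpace ℝ (Fin M))
    (y : EuclideanSpace ℝ (Fin N)) (p : EuclideanSpace ℝ (Fin r)) : ℝ :=
  f x + (∑ i, g (h (y i))) + ⟪p, matVec A x + matVec B y - c⟫ +
    α / 2 * ‖matVec A x + matVec B y - c‖ ^ 2

/-- The ILR-ADMM scheme: `y^{k+1}` minimizes the linearized reweighted `y`-subproblem,
`x^{k+1}` minimizes the `x`-subproblem, and `p^{k+1} = p^k + α(Ax^{k+1} + By^{k+1} - c)`. -/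
def ILRADMM {M N r : ℕ} (f : EuclideanSpace ℝ (Fin M) → ℝ) (g h : ℝ → ℝ)
    (A : Matrix (Fin r) (Fin M) ℝ) (B : Matrix (Fin r) (Fin N) ℝ)
    (c : EuclideanSpace ℝ (Fin r)) (α ρ : ℝ)
    (x : ℕ → EuclideanSpace ℝ (Fin M)) (y : ℕ → EuclideanSpace ℝ (Fin N))
    (p : ℕ → EuclideanSpace ℝ (Fin r)) : Prop :=
  (∀ k, ∀ z : EuclideanSpace ℝ (Fin N),
      (∑ i, deriv g (h (y k i)) * h (y (k + 1) i)) +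
          ⟪p k + α • (matVec A (x k) + matVec B (y k) - c), matVec B (y (k + 1))⟫ +
          ρ / 2 * ‖y (k + 1) - y k‖ ^ 2 ≤
        (∑ i, deriv g (h (y k i)) * h (z i)) +
          ⟪p k + α • (matVec A (x k) + matVec B (y k) - c), matVec B z⟫ +
          ρ / 2 * ‖z - y k‖ ^ 2) ∧
    (∀ k, ∀ w : EuclideanSpace ℝ (Fin M),
      f (x (k + 1)) + ⟪p k, matVec A (x (k + 1))⟫ +
          α / 2 * ‖matVec A (x (k + 1)) + matVec B (y (k + 1)) - c‖ ^ 2 ≤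
        f w + ⟪p k, matVec A w⟫ + α / 2 * ‖matVec A w + matVec B (y (k + 1)) - c‖ ^ 2) ∧
    (∀ k, p (k + 1) = p k + α • (matVec A (x (k + 1)) + matVec B (y (k + 1)) - c))

theorem ConcaveOn.le_tangent {g : ℝ → ℝ} (hgc : ConcaveOn ℝ Set.univ g) (hg : Differentiable ℝ g)
    (s t : ℝ) : g t ≤ g s + deriv g s * (t - s) := by
  rcases lt_trichotomy s t with hst | rfl | hst
  · have := hgc.slope_le_deriv (Set.mem_univ s) (Set.mem_univ t) hst (hg s)
    rw [slope_def_field, div_le_iff₀ (sub_pos.2 hst)] at this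
    linarith
  · simp
  · have := hgc.deriv_le_slope (Set.mem_univ t) (Set.mem_univ s) hst (hg s)
    rw [slope_def_field, le_div_iff₀ (sub_pos.2 hst)] at this
    linarith

theorem norm_sq_convex_combination {E : Type*} [NormedAddCommGroup E] [InnerProductSpace ℝ E]
    (u v : E) (t : ℝ) :
    ‖(1 - t) • u + t • v‖ ^ 2 =
      (1 - t) * ‖u‖ ^ 2 + t * ‖v‖ ^ 2 - t * (1 - t) * ‖u - v‖ ^ 2 := by
  rw [norm_add_sq_real, norm_sub_sq_real, norm_smul, norm_smul, mul_pow, mul_pow,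
    real_inner_smul_left, real_inner_smul_right, Real.norm_eq_abs, Real.norm_eq_abs, sq_abs,
    sq_abs]
  ring

section InnerProduct

variable {E F : Type*} [NormedAddCommGroup E] [InnerProductSpace ℝ E]
  [NormedAddCommGroup F] [InnerProductSpace ℝ F]

/-- First-order optimality for a penalized linear composite problem. -/
theorem gradient_eq_of_minimizes_penalized [CompleteSpace E] [CompleteSpace F]
    {f : E → ℝ} {u d : E} (hf : HasGradientAt f d u)
    (T : E →L[ℝ] F) (p b : F) (α : ℝ)
    (hmin : ∀ w, f u + ⟪p, T u⟫ + α / 2 * ‖T u + b‖ ^ 2 ≤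
      f w + ⟪p, T w⟫ + α / 2 * ‖T w + b‖ ^ 2) :
    d = -(ContinuousLinearMap.adjoint T (p + α • (T u + b))) := by
  have h1 : HasFDerivAt (fun w => ⟪p, T w⟫) ((innerSL ℝ p).comp T) u :=
    ((innerSL ℝ p).comp T).hasFDerivAt
  have h2 : HasFDerivAt (fun w => ‖T w + b‖ ^ 2) (2 • (innerSL ℝ (T u + b)).comp T) u :=
    (T.hasFDerivAt.add_const b).norm_sq
  have h3 := (hf.hasFDerivAt.add h1).add (h2.const_mul (α / 2))
  have h4 := IsLocalMin.hasFDerivAt_eq_zero (Eventually.of_forall hmin) h3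
  refine ext_inner_right ℝ fun v => ?_
  have h5 := congrArg (fun S : E →L[ℝ] ℝ => S v) h4
  simp at h5
  rw [inner_neg_left, ContinuousLinearMap.adjoint_inner_left, inner_add_left,
    real_inner_smul_left, inner_add_left]
  linarith

/-- A minimizer of a penalized problem which is strongly convex enjoys quadratic growth. -/
theorem quadratic_growth_of_minimizes_penalized {f : E → ℝ} (T : E →L[ℝ] F) {δ α : ℝ}
    (hα : 1 ≤ α)
    (hstrong : ConvexOn ℝ Set.univ (fun x => f x + ‖T x‖ ^ 2 / 2 - δ / 2 * ‖x‖ ^ 2))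
    {u : E} (p b : F)
    (hmin : ∀ w, f u + ⟪p, T u⟫ + α / 2 * ‖T u + b‖ ^ 2 ≤
      f w + ⟪p, T w⟫ + α / 2 * ‖T w + b‖ ^ 2) (v : E) :
    f u + ⟪p, T u⟫ + α / 2 * ‖T u + b‖ ^ 2 + δ / 2 * ‖u - v‖ ^ 2 ≤
      f v + ⟪p, T v⟫ + α / 2 * ‖T v + b‖ ^ 2 := by
  set D := (f v + ⟪p, T v⟫ + α / 2 * ‖T v + b‖ ^ 2) -
    (f u + ⟪p, T u⟫ + α / 2 * ‖T u + b‖ ^ 2) with hD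
  have key : ∀ t ∈ Set.Ioo (0 : ℝ) 1, (1 - t) * (δ / 2 * ‖u - v‖ ^ 2) ≤ D := by
    rintro t ⟨ht0, ht1⟩
    have hc := hstrong.2 (Set.mem_univ u) (Set.mem_univ v) (sub_nonneg.2 ht1.le) ht0.le
      (sub_add_cancel 1 t)
    have hm := hmin ((1 - t) • u + t • v)
    have hTb : T ((1 - t) • u + t • v) + b = (1 - t) • (T u + b) + t • (T v + b) := by
      simp only [map_add, map_smul]
      module
    rw [hTb, norm_sq_convex_combination (T u + b), add_sub_add_right_eq_sub] at hm
    simp only [map_add, map_smul, smul_eq_mul, norm_sq_convex_combination, inner_add_right,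
      real_inner_smul_right] at hc hm
    have hpos : 0 ≤ (α - 1) / 2 * (t * (1 - t) * ‖T u - T v‖ ^ 2) := by
      have := sub_nonneg.2 ht1.le
      have := sub_nonneg.2 hα
      positivity
    refine le_of_mul_le_mul_left ?_ ht0
    rw [hD]
    linarith
  have hlim : Tendsto (fun t : ℝ => (1 - t) * (δ / 2 * ‖u - v‖ ^ 2)) (𝓝[>] 0)
      (𝓝 ((1 - 0) * (δ / 2 * ‖u - v‖ ^ 2))) :=
    (Continuous.tendsto (by fun_prop) 0).mono_left nhdsWithin_le_nhds
  have hle := le_of_tendsto hlim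
    (Filter.mem_of_superset (Ioo_mem_nhdsGT one_pos) key)
  linarith

end InnerProduct

/-- A real sequence bounded below which eventually decreases by at least `d k` at each step
forces `d` to vanish at infinity. -/
theorem tendsto_zero_of_sufficient_decrease {L d : ℕ → ℝ} (hd : ∀ k, 0 ≤ d k)
    (hdec : ∀ k, 1 ≤ k → L (k + 1) + d k ≤ L k) (hL : BddBelow (Set.range L)) :
    Tendsto d atTop (𝓝 0) := by
  rw [← tendsto_add_atTop_iff_nat 1]
  have hanti : Antitone fun k => L (k + 1) :=
    antitone_nat_of_succ_le fun k => by linarith [hd (k + 1), hdec (k + 1) (by omega)]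
  have hbdd : BddBelow (Set.range fun k => L (k + 1)) :=
    hL.mono (Set.range_subset_iff.2 fun k => Set.mem_range_self (k + 1))
  have h1 := tendsto_atTop_ciInf hanti hbdd
  have h2 := h1.sub ((tendsto_add_atTop_iff_nat 1).2 h1)
  rw [sub_self] at h2
  exact squeeze_zero (fun k => hd _) (fun k => by linarith [hdec (k + 1) (by omega)]) h2

theorem tendsto_zero_of_const_mul_sq_le {a : ℝ} (ha : 0 < a) {u d : ℕ → ℝ}
    (hu : ∀ᶠ k in atTop, a * u k ^ 2 ≤ d k) (hd : Tendsto d atTop (𝓝 0)) :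
    Tendsto u atTop (𝓝 0) := by
  have h1 : Tendsto (fun k => u k ^ 2) atTop (𝓝 0) := by
    refine squeeze_zero' (Eventually.of_forall fun k => sq_nonneg _) ?_
      (by simpa using hd.div_const a)
    filter_upwards [hu] with k hk
    rw [le_div_iff₀ ha]
    linarith
  have h2 := h1.sqrt
  simp only [Real.sqrt_sq_eq_abs, Real.sqrt_zero] at h2
  exact (tendsto_zero_iff_abs_tendsto_zero u).2 h2

section ILRADMM

variable {M N r : ℕ}

theorem adjoint_toEuclideanLin_apply (A : Matrix (Fin r) (Fin M) ℝ)
    (u : EuclideanSpace ℝ (Fin r)) :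
    ContinuousLinearMap.adjoint (Matrix.toEuclideanLin A).toContinuousLinearMap u =
      matVec Aᵀ u := by
  refine ext_inner_right ℝ fun v => ?_
  rw [ContinuousLinearMap.adjoint_inner_left, matVec,
    ← Matrix.conjTranspose_eq_transpose_of_trivial,
    Matrix.toEuclideanLin_conjTranspose_eq_adjoint, LinearMap.adjoint_inner_left]
  rfl

theorem norm_matVec_le (B : Matrix (Fin r) (Fin N) ℝ) (z : EuclideanSpace ℝ (Fin N)) :
    ‖matVec B z‖ ≤ opNorm2 B * ‖z‖ :=
  (Matrix.toEuclideanLin B).toContinuousLinearMap.le_opNorm z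

theorem continuous_matVec (B : Matrix (Fin r) (Fin N) ℝ) : Continuous (matVec B) :=
  (Matrix.toEuclideanLin B).toContinuousLinearMap.continuous

theorem bddBelow_range_Lag {f : EuclideanSpace ℝ (Fin M) → ℝ} {g h : ℝ → ℝ}
    (hf : Continuous f) (hg : Continuous g) (hh : Continuous h)
    (A : Matrix (Fin r) (Fin M) ℝ) (B : Matrix (Fin r) (Fin N) ℝ)
    (c : EuclideanSpace ℝ (Fin r)) (α : ℝ)
    {x : ℕ → EuclideanSpace ℝ (Fin M)} {y : ℕ → EuclideanSpace ℝ (Fin N)}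
    {p : ℕ → EuclideanSpace ℝ (Fin r)}
    (hbdd : ∃ C : ℝ, ∀ k, ‖x k‖ ≤ C ∧ ‖y k‖ ≤ C ∧ ‖p k‖ ≤ C) :
    BddBelow (Set.range fun k => Lag f g h A B c α (x k) (y k) (p k)) := by
  obtain ⟨C, hC⟩ := hbdd
  have hcont : Continuous fun q : EuclideanSpace ℝ (Fin M) × EuclideanSpace ℝ (Fin N) ×
      EuclideanSpace ℝ (Fin r) => Lag f g h A B c α q.1 q.2.1 q.2.2 := by
    have hA := continuous_matVec A
    have hB := continuous_matVec B
    unfold Lag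
    fun_prop
  have hK := ((isCompact_closedBall (0 : EuclideanSpace ℝ (Fin M)) C).prod
    ((isCompact_closedBall (0 : EuclideanSpace ℝ (Fin N)) C).prod
      (isCompact_closedBall (0 : EuclideanSpace ℝ (Fin r)) C))).bddBelow_image
        hcont.continuousOn
  refine hK.mono ?_
  rintro _ ⟨k, rfl⟩
  exact ⟨(x k, y k, p k), by simpa [Set.mem_prod] using hC k, rfl⟩

/-- Decrease of the augmented Lagrangian in the linearized reweighted step. -/
theorem Lag_add_le_of_reweighted_step (f : EuclideanSpace ℝ (Fin M) → ℝ) {g h : ℝ → ℝ}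
    (hg : Differentiable ℝ g) (hgc : ConcaveOn ℝ Set.univ g)
    (A : Matrix (Fin r) (Fin M) ℝ) (B : Matrix (Fin r) (Fin N) ℝ)
    (c : EuclideanSpace ℝ (Fin r)) {α ρ : ℝ} (hα : 0 ≤ α)
    (x : EuclideanSpace ℝ (Fin M)) (y z : EuclideanSpace ℝ (Fin N))
    (p : EuclideanSpace ℝ (Fin r))
    (hz : (∑ i, deriv g (h (y i)) * h (z i)) +
          ⟪p + α • (matVec A x + matVec B y - c), matVec B z⟫ + ρ / 2 * ‖z - y‖ ^ 2 ≤
        (∑ i, deriv g (h (y i)) * h (y i)) +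
          ⟪p + α • (matVec A x + matVec B y - c), matVec B y⟫ + ρ / 2 * ‖y - y‖ ^ 2) :
    Lag f g h A B c α x z p + (ρ - α * opNorm2 B ^ 2) / 2 * ‖z - y‖ ^ 2 ≤
      Lag f g h A B c α x y p := by
  have hsum : ∑ i, g (h (z i)) ≤ ∑ i, g (h (y i)) +
      (∑ i, deriv g (h (y i)) * h (z i) - ∑ i, deriv g (h (y i)) * h (y i)) := by
    rw [← Finset.sum_sub_distrib, ← Finset.sum_add_distrib]
    refine Finset.sum_le_sum fun i _ => ?_
    have := hgc.le_tangent hg (h (y i)) (h (z i))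
    linarith
  have hB : ‖matVec B (z - y)‖ ^ 2 ≤ opNorm2 B ^ 2 * ‖z - y‖ ^ 2 := by
    rw [← mul_pow]
    exact pow_le_pow_left₀ (norm_nonneg _) (norm_matVec_le B _) 2
  have hBsub : matVec B (z - y) = matVec B z - matVec B y := map_sub (Matrix.toEuclideanLin B) z y
  have hres : matVec A x + matVec B z - c =
      (matVec A x + matVec B y - c) + (matVec B z - matVec B y) := by abel
  rw [hBsub] at hB
  unfold Lag
  rw [hres]
  generalize matVec A x + matVec B y - c = s at *
  rw [norm_add_sq_real]
  simp only [inner_add_left, inner_add_right, inner_sub_right, real_inner_smul_left, sub_self,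
    norm_zero] at hz ⊢
  have hB' := mul_le_mul_of_nonneg_left hB hα
  linarith

end ILRADMM

/-- Under the hypotheses of the descent lemma, if the ILR-ADMM
sequence is bounded, then `‖x^{k+1}-x^k‖ + ‖y^{k+1}-y^k‖ → 0` and `‖p^{k+1}-p^k‖ → 0`. -/
theorem stmt11 {M N r : ℕ} (f : EuclideanSpace ℝ (Fin M) → ℝ)
    (f' : EuclideanSpace ℝ (Fin M) → EuclideanSpace ℝ (Fin M))
    (hgrad : ∀ x, HasGradientAt f (f' x) x)
    (hfconv : ConvexOn ℝ Set.univ f)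
    (Lf : ℝ) (hlip : ∀ x y, ‖f' x - f' y‖ ≤ Lf * ‖x - y‖)
    (A : Matrix (Fin r) (Fin M) ℝ) (B : Matrix (Fin r) (Fin N) ℝ)
    (c : EuclideanSpace ℝ (Fin r))
    (δ : ℝ) (hδ : 0 < δ)
    (hstrong : ConvexOn ℝ Set.univ
      (fun x : EuclideanSpace ℝ (Fin M) =>
        f x + ‖matVec A x‖ ^ 2 / 2 - δ / 2 * ‖x‖ ^ 2))
    (h : ℝ → ℝ) (hconv : ConvexOn ℝ Set.univ h)
    (g : ℝ → ℝ) (hg : Differentiable ℝ g) (hgc : ConcaveOn ℝ Set.univ g)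
    (Lg : ℝ) (hgl : ∀ s t, |deriv g s - deriv g t| ≤ Lg * |s - t|)
    (hgpos : ∀ t ∈ Set.range h, 0 < deriv g t)
    (θ : ℝ) (hθ : 0 < θ)
    (hA : ∀ u ∈ LinearMap.range (Matrix.toEuclideanLin A), θ * ‖u‖ ≤ ‖matVec Aᵀ u‖)
    (η : ℝ) (hη : η = Lf ^ 2 / θ ^ 2)
    (hrange : LinearMap.range (Matrix.toEuclideanLin B) ≤
      LinearMap.range (Matrix.toEuclideanLin A))
    (hc : c ∈ LinearMap.range (Matrix.toEuclideanLin A))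
    (α ρ : ℝ) (hα : α > max 1 (2 * η / δ)) (hρ : ρ > α * opNorm2 B ^ 2)
    (x : ℕ → EuclideanSpace ℝ (Fin M)) (y : ℕ → EuclideanSpace ℝ (Fin N))
    (p : ℕ → EuclideanSpace ℝ (Fin r))
    (hscheme : ILRADMM f g h A B c α ρ x y p)
    (hbdd : ∃ C : ℝ, ∀ k, ‖x k‖ ≤ C ∧ ‖y k‖ ≤ C ∧ ‖p k‖ ≤ C) :
    Tendsto (fun k => ‖x (k + 1) - x k‖ + ‖y (k + 1) - y k‖) atTop (𝓝 0) ∧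
      Tendsto (fun k => ‖p (k + 1) - p k‖) atTop (𝓝 0) := by
  obtain ⟨hy, hx, hp⟩ := hscheme
  have hα1 : 1 < α := (le_max_left _ _).trans_lt hα
  have hα0 : 0 < α := one_pos.trans hα1
  have hαη : 2 * η / δ < α := (le_max_right _ _).trans_lt hα
  have hx' := hx
  simp only [add_sub_assoc] at hx'
  have hstat (k : ℕ) : f' (x (k + 1)) = -matVec Aᵀ (p (k + 1)) := by
    rw [gradient_eq_of_minimizes_penalized (hgrad (x (k + 1)))
      (Matrix.toEuclideanLin A).toContinuousLinearMap (p k) (matVec B (y (k + 1)) - c) α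
      (hx' k),
      adjoint_toEuclideanLin_apply, hp k, add_sub_assoc]
    rfl
  have hΔp (k : ℕ) (hk : 1 ≤ k) : ‖p (k + 1) - p k‖ ^ 2 ≤ η * ‖x (k + 1) - x k‖ ^ 2 := by
    obtain ⟨j, rfl⟩ := Nat.exists_eq_add_of_le' hk
    have hmem : p (j + 1 + 1) - p (j + 1) ∈ LinearMap.range (Matrix.toEuclideanLin A) := by
      rw [hp (j + 1), add_sub_cancel_left]
      exact Submodule.smul_mem _ _ (Submodule.sub_mem _ (Submodule.add_mem _ ⟨_, rfl⟩
        (hrange ⟨_, rfl⟩)) hc)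
    have h1 := hA _ hmem
    have h2 : matVec Aᵀ (p (j + 1 + 1) - p (j + 1)) =
        -(f' (x (j + 1 + 1)) - f' (x (j + 1))) := by
      rw [hstat (j + 1), hstat j, matVec, map_sub, matVec, matVec]
      abel
    rw [h2, norm_neg] at h1
    have h3 := pow_le_pow_left₀ (by positivity) (h1.trans (hlip _ _)) 2
    rw [mul_pow, mul_pow] at h3
    rw [hη, div_mul_eq_mul_div, le_div_iff₀ (by positivity)]
    linarith
  have hdec (k : ℕ) (hk : 1 ≤ k) :
      Lag f g h A B c α (x (k + 1)) (y (k + 1)) (p (k + 1)) +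
        ((δ / 2 - η / α) * ‖x (k + 1) - x k‖ ^ 2 +
          (ρ - α * opNorm2 B ^ 2) / 2 * ‖y (k + 1) - y k‖ ^ 2) ≤
      Lag f g h A B c α (x k) (y k) (p k) := by
    have h1 := Lag_add_le_of_reweighted_step f hg hgc A B c hα0.le (x k) (y k) (y (k + 1)) (p k)
      (hy k (y k))
    have h2 := quadratic_growth_of_minimizes_penalized
      (Matrix.toEuclideanLin A).toContinuousLinearMap hα1.le hstrong (p k)
      (matVec B (y (k + 1)) - c)
      (hx' k) (x k)
    change f (x (k + 1)) + ⟪p k, matVec A (x (k + 1))⟫ +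
        α / 2 * ‖matVec A (x (k + 1)) + (matVec B (y (k + 1)) - c)‖ ^ 2 +
        δ / 2 * ‖x (k + 1) - x k‖ ^ 2 ≤
      f (x k) + ⟪p k, matVec A (x k)⟫ +
        α / 2 * ‖matVec A (x k) + (matVec B (y (k + 1)) - c)‖ ^ 2 at h2
    have h3 : ⟪p (k + 1) - p k, matVec A (x (k + 1)) + matVec B (y (k + 1)) - c⟫ =
        ‖p (k + 1) - p k‖ ^ 2 / α := by
      rw [hp k, add_sub_cancel_left, real_inner_smul_left, real_inner_self_eq_norm_sq, norm_smul,
        Real.norm_of_nonneg hα0.le]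
      field_simp
    have h4 : ‖p (k + 1) - p k‖ ^ 2 / α ≤ η / α * ‖x (k + 1) - x k‖ ^ 2 := by
      rw [div_mul_eq_mul_div]
      exact div_le_div_of_nonneg_right (hΔp k hk) hα0.le
    unfold Lag at h1 ⊢
    simp only [inner_sub_left, inner_sub_right, inner_add_right, add_sub_assoc] at h1 h2 h3 ⊢
    linarith
  have ha : 0 < δ / 2 - η / α := by
    rw [div_lt_iff₀ hδ] at hαη
    rw [sub_pos, div_lt_div_iff₀ hα0 two_pos]
    linarith
  have hb : 0 < (ρ - α * opNorm2 B ^ 2) / 2 := by linarith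
  have hfcont : Continuous f :=
    continuous_iff_continuousAt.2 fun z => (hgrad z).hasFDerivAt.continuousAt
  have hhcont : Continuous h :=
    continuousOn_univ.1 (hconv.continuousOn isOpen_univ)
  have hd := tendsto_zero_of_sufficient_decrease (fun k => by positivity) hdec
    (bddBelow_range_Lag hfcont hg.continuous hhcont A B c α hbdd)
  have hxlim : Tendsto (fun k => ‖x (k + 1) - x k‖) atTop (𝓝 0) :=
    tendsto_zero_of_const_mul_sq_le ha
      (Eventually.of_forall fun k => le_add_of_nonneg_right (by positivity)) hd
  have hylim : Tendsto (fun k => ‖y (k + 1) - y k‖) atTop (𝓝 0) :=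
    tendsto_zero_of_const_mul_sq_le hb
      (Eventually.of_forall fun k => le_add_of_nonneg_left (by positivity)) hd
  refine ⟨by simpa using hxlim.add hylim, ?_⟩
  refine tendsto_zero_of_const_mul_sq_le one_pos (d := fun k => η * ‖x (k + 1) - x k‖ ^ 2) ?_
    (by simpa using (hxlim.pow 2).const_mul η)
  filter_upwards [eventually_ge_atTop 1] with k hk
  simpa using hΔp k hk
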